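/- Let G be a finite group, p a prime, H ≤ G a subgroup, and T ∈ A_p(G) with T ∩ H = 1. Set N(H) = {X ∈ A_p(G) : X ∩ H ≠ 1}. Then the map i : A_p(C_H(T)) → N(H) ∩ A_p(G)_{>T} defined by i(A) = AT is a well-defined order-preserving map, the map r : N(H) ∩ A_p(G)_{>T} → A_p(C_H(T)) defined by r(X) = X ∩ H is well-defined and order-preserving, r ∘ i = id and i ∘ r ≤ id; consequently i induces a homotopy equivalence of the geometric realizations of the order complexes, exhibiting K(A_p(C_H(T))) as a (strong deformation) retract of K(N(H) ∩ A_p(G)_{>T}). -/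

import Mathlib

open Function

/-- The geometric realization of the order complex of the subposet `S` of `X`,
realized as a subspace of `X → ℝ`: convex combinations supported on finite
nonempty chains contained in `S`. -/
def geomRealOn {X : Type*} [Preorder X] (S : Set X) : Set (X → ℝ) :=
  {f | (∀ x, 0 ≤ f x) ∧ Function.support f ⊆ S ∧ IsChain (· ≤ ·) (Function.support f) ∧
    ∃ s : Finset X, Function.support f ⊆ ↑s ∧ ∑ x ∈ s, f x = 1}

/-- A group is elementary abelian for the prime `p` if it is abelian and
every element has order dividing `p`. -/
def IsElementaryAbelian (p : ℕ) (G : Type*) [Group G] : Prop :=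
  (∀ a b : G, a * b = b * a) ∧ ∀ a : G, a ^ p = 1

/-- The Quillen poset `A_p(G)`: nontrivial elementary abelian `p`-subgroups of `G`. -/
def apSet (p : ℕ) (G : Type*) [Group G] : Set (Subgroup G) :=
  {H | H ≠ ⊥ ∧ IsElementaryAbelian p ↥H}

/-- The poset `A_p(K)` for a subgroup `K ≤ G`, realized inside the subgroup lattice
of `G` as the nontrivial elementary abelian `p`-subgroups contained in `K`. -/
def apSetIn (p : ℕ) {G : Type*} [Group G] (K : Subgroup G) : Set (Subgroup G) :=
  {H | H ≠ ⊥ ∧ IsElementaryAbelian p ↥H ∧ H ≤ K}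

section Pushforward

variable {X : Type*} [Fintype X]

open Classical in
/-- The pushforward of a finitely supported mass distribution along a map. -/
noncomputable def pushMass (f : X → X) (φ : X → ℝ) (y : X) : ℝ :=
  ∑ x, if f x = y then φ x else 0

theorem continuous_pushMass (f : X → X) : Continuous (pushMass f) := by
  classical
  refine continuous_pi fun y => continuous_finsetSum _ fun x _ => ?_
  by_cases h : f x = y
  · simpa [h] using continuous_apply x
  · simpa [h] using continuous_const

theorem pushMass_nonneg (f : X → X) {φ : X → ℝ} (hφ : ∀ x, 0 ≤ φ x) (y : X) :
    0 ≤ pushMass f φ y := by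
  classical
  refine Finset.sum_nonneg fun x _ => ?_
  split_ifs
  exacts [hφ x, le_rfl]

theorem sum_pushMass (f : X → X) (φ : X → ℝ) : ∑ y, pushMass f φ y = ∑ x, φ x := by
  classical
  unfold pushMass
  rw [Finset.sum_comm]
  simp

theorem support_pushMass_subset (f : X → X) (φ : X → ℝ) :
    support (pushMass f φ) ⊆ f '' support φ := by
  classical
  intro y hy
  obtain ⟨x, -, hx⟩ := Finset.exists_ne_zero_of_sum_ne_zero hy
  by_cases h : f x = y
  · exact ⟨x, by simpa [h] using hx, h⟩
  · simp [h] at hx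

theorem pushMass_comp (f g : X → X) (φ : X → ℝ) :
    pushMass f (pushMass g φ) = pushMass (f ∘ g) φ := by
  classical
  funext z
  simp only [pushMass, comp_apply, ← Finset.sum_filter]
  simp only [Finset.sum_filter]
  have h : ∀ y, (if f y = z then ∑ x, if g x = y then φ x else 0 else 0) =
      ∑ x, if g x = y then (if f y = z then φ x else 0) else 0 := by
    intro y
    split_ifs <;> simp
  simp only [h]
  rw [Finset.sum_comm]
  simp

theorem pushMass_eq_self {f : X → X} {φ : X → ℝ} (h : ∀ x ∈ support φ, f x = x) :
    pushMass f φ = φ := by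
  classical
  funext y
  have h' : ∀ x, (if f x = y then φ x else 0) = if x = y then φ x else 0 := by
    intro x
    by_cases hx : φ x = 0
    · simp [hx]
    · rw [h x hx]
  simp only [pushMass, h']
  simp

end Pushforward

section LowerMass

variable {X : Type*} [Fintype X] [PartialOrder X]

open Classical in
/-- The total mass strictly below a point. -/
noncomputable def massBelow (φ : X → ℝ) (x : X) : ℝ :=
  ∑ y, if y < x then φ y else 0

/-- For `φ` supported on a chain, the part of `φ` made of the lowest `t` units of mass. -/
noncomputable def lowerMass (t : ℝ) (φ : X → ℝ) (x : X) : ℝ :=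
  min t (massBelow φ x + φ x) - min t (massBelow φ x)

theorem continuous_massBelow (x : X) : Continuous fun φ : X → ℝ => massBelow φ x := by
  classical
  refine continuous_finsetSum _ fun y _ => ?_
  by_cases h : y < x
  · simpa [h] using continuous_apply y
  · simpa [h] using continuous_const

theorem continuous_lowerMass : Continuous fun q : ℝ × (X → ℝ) => lowerMass q.1 q.2 := by
  refine continuous_pi fun x => ?_
  have h : Continuous fun q : ℝ × (X → ℝ) => massBelow q.2 x :=
    (continuous_massBelow x).comp continuous_snd
  have h' : Continuous fun q : ℝ × (X → ℝ) => q.2 x := (continuous_apply x).comp continuous_snd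
  exact (continuous_fst.min (h.add h')).sub (continuous_fst.min h)

theorem massBelow_nonneg {φ : X → ℝ} (hφ : ∀ x, 0 ≤ φ x) (x : X) : 0 ≤ massBelow φ x := by
  classical
  refine Finset.sum_nonneg fun y _ => ?_
  split_ifs
  exacts [hφ y, le_rfl]

theorem massBelow_add_eq (φ : X → ℝ) (x : X) [DecidableLE X] :
    massBelow φ x + φ x = ∑ y, if y ≤ x then φ y else 0 := by
  classical
  have h : φ x = ∑ y, if y = x then φ y else 0 := by simp
  rw [h, massBelow, ← Finset.sum_add_distrib]
  refine Finset.sum_congr rfl fun y _ => ?_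
  by_cases hyx : y = x
  · simp [hyx]
  · simp [hyx, lt_iff_le_and_ne]

theorem massBelow_add_le_sum {φ : X → ℝ} (hφ : ∀ x, 0 ≤ φ x) (x : X) :
    massBelow φ x + φ x ≤ ∑ y, φ y := by
  classical
  rw [massBelow_add_eq]
  refine Finset.sum_le_sum fun y _ => ?_
  split_ifs
  exacts [le_rfl, hφ y]

theorem massBelow_add_le_of_lt {φ : X → ℝ} (hφ : ∀ x, 0 ≤ φ x) {x y : X} (h : y < x) :
    massBelow φ y + φ y ≤ massBelow φ x := by
  classical
  rw [massBelow_add_eq, massBelow]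
  refine Finset.sum_le_sum fun z _ => ?_
  by_cases hz : z ≤ y
  · simp [hz, hz.trans_lt h]
  · rw [if_neg hz]
    split_ifs
    exacts [hφ z, le_rfl]

theorem lowerMass_nonneg {φ : X → ℝ} (hφ : ∀ x, 0 ≤ φ x) (t : ℝ) (x : X) :
    0 ≤ lowerMass t φ x :=
  sub_nonneg.2 (min_le_min_left _ (le_add_of_nonneg_right (hφ x)))

theorem lowerMass_le {φ : X → ℝ} (hφ : ∀ x, 0 ≤ φ x) (t : ℝ) (x : X) :
    lowerMass t φ x ≤ φ x := by
  have := hφ x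
  unfold lowerMass
  rcases le_total t (massBelow φ x) with h | h
  · rw [min_eq_left h, min_eq_left (by linarith)]
    linarith
  · rw [min_eq_right h]
    linarith [min_le_right t (massBelow φ x + φ x)]

theorem lowerMass_zero {φ : X → ℝ} (hφ : ∀ x, 0 ≤ φ x) : lowerMass 0 φ = 0 := by
  funext x
  have h := massBelow_nonneg hφ x
  have := hφ x
  rw [lowerMass, min_eq_left h, min_eq_left (by linarith)]
  simp

theorem lowerMass_one {φ : X → ℝ} (hφ : ∀ x, 0 ≤ φ x) (h1 : ∑ x, φ x = 1) :
    lowerMass 1 φ = φ := by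
  funext x
  have h := massBelow_add_le_sum hφ x
  have := hφ x
  rw [lowerMass, min_eq_right (by linarith), min_eq_right (by linarith)]
  ring

theorem massBelow_lt_of_lowerMass_ne_zero {φ : X → ℝ} (hφ : ∀ x, 0 ≤ φ x) {t : ℝ} {x : X}
    (h : lowerMass t φ x ≠ 0) : massBelow φ x < t := by
  by_contra! hx
  have := hφ x
  exact h (by rw [lowerMass, min_eq_left hx, min_eq_left (by linarith), sub_self])

theorem lt_massBelow_add_of_lowerMass_ne {φ : X → ℝ} (hφ : ∀ x, 0 ≤ φ x) {t : ℝ} {x : X}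
    (h : φ x - lowerMass t φ x ≠ 0) : t < massBelow φ x + φ x := by
  by_contra! hx
  have := hφ x
  exact h (by rw [lowerMass, min_eq_right hx, min_eq_right (by linarith)]; ring)

theorem le_of_lowerMass_ne {φ : X → ℝ} (hφ : ∀ x, 0 ≤ φ x)
    (hc : IsChain (· ≤ ·) (support φ)) {t : ℝ} {x y : X} (hx : x ∈ support φ)
    (hy : y ∈ support φ) (hxt : lowerMass t φ x ≠ 0) (hyt : φ y - lowerMass t φ y ≠ 0) :
    x ≤ y := by
  by_contra hxy
  have hyx : y < x := lt_of_le_not_ge ((hc.total hx hy).resolve_left hxy) hxy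
  linarith [massBelow_lt_of_lowerMass_ne_zero hφ hxt, lt_massBelow_add_of_lowerMass_ne hφ hyt,
    massBelow_add_le_of_lt hφ hyx]

end LowerMass

section Realization

theorem isChain_image_of_monotoneOn {X : Type*} [PartialOrder X] {S : Set X} {f : X → X}
    (hf : MonotoneOn f S) {c : Set X} (hcS : c ⊆ S) (hc : IsChain (· ≤ ·) c) :
    IsChain (· ≤ ·) (f '' c) := by
  rintro _ ⟨x, hx, rfl⟩ _ ⟨y, hy, rfl⟩ -
  exact (hc.total hx hy).imp (hf (hcS hx) (hcS hy)) (hf (hcS hy) (hcS hx))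

variable {X : Type*} [Fintype X] [PartialOrder X]

theorem mem_geomRealOn_iff {S : Set X} {φ : X → ℝ} :
    φ ∈ geomRealOn S ↔ (∀ x, 0 ≤ φ x) ∧ support φ ⊆ S ∧
      IsChain (· ≤ ·) (support φ) ∧ ∑ x, φ x = 1 := by
  refine and_congr_right fun _ => and_congr_right fun _ => and_congr_right fun _ => ⟨?_, ?_⟩
  · rintro ⟨s, hs, h⟩
    rw [← h]
    refine (Finset.sum_subset (Finset.subset_univ s) fun x _ hx => ?_).symm
    by_contra hne
    exact hx (hs hne)
  · exact fun h => ⟨Finset.univ, by simp, h⟩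

theorem pushMass_mem_geomRealOn {S R : Set X} {f : X → X} (hf : Set.MapsTo f S R)
    (hm : MonotoneOn f S) {φ : X → ℝ} (hφ : φ ∈ geomRealOn S) :
    pushMass f φ ∈ geomRealOn R := by
  rw [mem_geomRealOn_iff] at hφ ⊢
  obtain ⟨h0, hS, hc, h1⟩ := hφ
  refine ⟨pushMass_nonneg f h0, ?_, ?_, by rw [sum_pushMass, h1]⟩
  · exact (support_pushMass_subset f φ).trans ((Set.image_mono hS).trans hf.image_subset)
  · exact (isChain_image_of_monotoneOn hm hS hc).mono (support_pushMass_subset f φ)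

/-- Moving the lowest `t` units of mass down along a monotone decreasing map keeps the support a
chain. -/
theorem pushMass_lowerMass_add_mem_geomRealOn {S : Set X} {g : X → X} (hg : Set.MapsTo g S S)
    (hm : MonotoneOn g S) (hle : ∀ x ∈ S, g x ≤ x) (t : ℝ) {φ : X → ℝ}
    (hφ : φ ∈ geomRealOn S) :
    pushMass g (lowerMass t φ) + (φ - lowerMass t φ) ∈ geomRealOn S := by
  rw [mem_geomRealOn_iff] at hφ ⊢
  obtain ⟨h0, hS, hc, h1⟩ := hφ
  have hlow : support (lowerMass t φ) ⊆ support φ := fun x hx hx0 =>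
    hx (le_antisymm ((lowerMass_le h0 t x).trans_eq hx0) (lowerMass_nonneg h0 t x))
  have hupp : support (φ - lowerMass t φ) ⊆ support φ := by
    intro x hx hx0
    have hx' : lowerMass t φ x = 0 := not_not.1 fun h => hlow h hx0
    exact hx (by simp [hx0, hx'])
  have hsupp : support (pushMass g (lowerMass t φ) + (φ - lowerMass t φ)) ⊆
      g '' support (lowerMass t φ) ∪ support (φ - lowerMass t φ) :=
    (support_add _ _).trans (Set.union_subset_union_left _ (support_pushMass_subset g _))
  refine ⟨fun x => ?_, hsupp.trans (Set.union_subset ?_ (hupp.trans hS)), IsChain.mono hsupp ?_, ?_⟩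
  · exact add_nonneg (pushMass_nonneg g (lowerMass_nonneg h0 t) x)
      (sub_nonneg.2 (lowerMass_le h0 t x))
  · exact (Set.image_mono (hlow.trans hS)).trans hg.image_subset
  · have key : ∀ x ∈ support (lowerMass t φ), ∀ y ∈ support (φ - lowerMass t φ), g x ≤ y :=
      fun x hx y hy => (hm (hS (hlow hx)) (hS (hupp hy))
        (le_of_lowerMass_ne h0 hc (hlow hx) (hupp hy) hx hy)).trans (hle y (hS (hupp hy)))
    have himg := isChain_image_of_monotoneOn hm (hlow.trans hS) (hc.mono hlow)
    rintro a (ha | ha) b (hb | hb) hab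
    · exact himg ha hb hab
    · obtain ⟨x, hx, rfl⟩ := ha
      exact Or.inl (key x hx b hb)
    · obtain ⟨x, hx, rfl⟩ := hb
      exact Or.inr (key x hx a ha)
    · exact hc (hupp ha) (hupp hb) hab
  · simp only [Pi.add_apply, Pi.sub_apply, Finset.sum_add_distrib, Finset.sum_sub_distrib,
      sum_pushMass, h1]
    ring

/-- The map of geometric realizations induced by a monotone map. -/
noncomputable def geomRealMap {S R : Set X} (f : X → X) (hf : Set.MapsTo f S R)
    (hm : MonotoneOn f S) : C(geomRealOn S, geomRealOn R) where
  toFun φ := ⟨pushMass f φ, pushMass_mem_geomRealOn hf hm φ.2⟩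
  continuous_toFun := ((continuous_pushMass f).comp continuous_subtype_val).subtype_mk _

theorem geomRealMap_homotopic_id {S : Set X} {g : X → X} (hg : Set.MapsTo g S S)
    (hm : MonotoneOn g S) (hle : ∀ x ∈ S, g x ≤ x) :
    (geomRealMap g hg hm).Homotopic (ContinuousMap.id (geomRealOn S)) := by
  refine ContinuousMap.Homotopic.symm ⟨⟨⟨fun q =>
    ⟨_, pushMass_lowerMass_add_mem_geomRealOn hg hm hle (q.1 : ℝ) q.2.2⟩, ?_⟩, ?_, ?_⟩⟩
  · have hφ : Continuous fun q : unitInterval × geomRealOn S => (q.2 : X → ℝ) :=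
      continuous_subtype_val.comp continuous_snd
    have hlow : Continuous fun q : unitInterval × geomRealOn S =>
        lowerMass (q.1 : ℝ) (q.2 : X → ℝ) :=
      continuous_lowerMass.comp ((continuous_subtype_val.comp continuous_fst).prodMk hφ)
    exact (((continuous_pushMass g).comp hlow).add (hφ.sub hlow)).subtype_mk _
  · intro φ
    have h0 := lowerMass_zero (mem_geomRealOn_iff.1 φ.2).1
    have hp : pushMass g 0 = 0 := by
      funext y
      simp [pushMass]
    exact Subtype.ext (by simp [h0, hp])
  · intro φ
    have h1 := lowerMass_one (mem_geomRealOn_iff.1 φ.2).1 (mem_geomRealOn_iff.1 φ.2).2.2.2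
    exact Subtype.ext (by simp [h1, geomRealMap])

/-- Monotone maps `i : S → R` and `r : R → S` with `r ∘ i = id` and `i ∘ r ≤ id` induce a homotopy
equivalence of geometric realizations. -/
theorem nonempty_homotopyEquiv_geomRealOn {S R : Set X} {i r : X → X}
    (hi : Set.MapsTo i S R) (him : MonotoneOn i S) (hr : Set.MapsTo r R S)
    (hrm : MonotoneOn r R) (hri : ∀ x ∈ S, r (i x) = x) (hir : ∀ x ∈ R, i (r x) ≤ x) :
    Nonempty (ContinuousMap.HomotopyEquiv (geomRealOn S) (geomRealOn R)) := by
  refine ⟨⟨geomRealMap i hi him, geomRealMap r hr hrm, ?_, ?_⟩⟩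
  · have h : (geomRealMap r hr hrm).comp (geomRealMap i hi him) = ContinuousMap.id _ := by
      ext1 φ
      refine Subtype.ext ((pushMass_comp r i φ).trans (pushMass_eq_self fun x hx => ?_))
      exact hri x ((mem_geomRealOn_iff.1 φ.2).2.1 hx)
    rw [h]
  · have h : (geomRealMap i hi him).comp (geomRealMap r hr hrm) =
        geomRealMap (i ∘ r) (hi.comp hr) (him.comp hrm hr) := by
      ext1 φ
      exact Subtype.ext (pushMass_comp i r φ)
    rw [h]
    exact geomRealMap_homotopic_id _ _ hir

end Realization

section ElementaryAbelian

variable {G : Type*} [Group G] {p : ℕ}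

theorem isElementaryAbelian_coe_iff {A : Subgroup G} :
    IsElementaryAbelian p A ↔
      (∀ a ∈ A, ∀ b ∈ A, a * b = b * a) ∧ ∀ a ∈ A, a ^ p = 1 := by
  simp [IsElementaryAbelian, Subtype.ext_iff]

theorem IsElementaryAbelian.mono {A B : Subgroup G} (hB : IsElementaryAbelian p B)
    (h : A ≤ B) : IsElementaryAbelian p A := by
  rw [isElementaryAbelian_coe_iff] at hB ⊢
  exact ⟨fun a ha b hb => hB.1 a (h ha) b (h hb), fun a ha => hB.2 a (h ha)⟩

theorem mem_sup_of_le_centralizer {A T : Subgroup G}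
    (h : A ≤ Subgroup.centralizer (T : Set G)) {x : G} :
    x ∈ A ⊔ T ↔ ∃ a ∈ A, ∃ t ∈ T, a * t = x := by
  rw [← SetLike.mem_coe, Subgroup.coe_mul_of_left_le_normalizer_right A T
    (h.trans (Subgroup.centralizer_le_normalizer _)), Set.mem_mul]
  rfl

theorem IsElementaryAbelian.sup {A T : Subgroup G} (hA : IsElementaryAbelian p A)
    (hT : IsElementaryAbelian p T) (h : A ≤ Subgroup.centralizer (T : Set G)) :
    IsElementaryAbelian p ↥(A ⊔ T) := by
  rw [isElementaryAbelian_coe_iff] at hA hT ⊢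
  have hc : ∀ a ∈ A, ∀ t ∈ T, Commute a t := fun a ha t ht =>
    (Subgroup.mem_centralizer_iff.1 (h ha) t ht).symm
  constructor
  · intro x hx y hy
    obtain ⟨a, ha, t, ht, rfl⟩ := (mem_sup_of_le_centralizer h).1 hx
    obtain ⟨b, hb, s, hs, rfl⟩ := (mem_sup_of_le_centralizer h).1 hy
    have h1 : Commute a b := hA.1 a ha b hb
    have h2 : Commute t s := hT.1 t ht s hs
    exact (h1.mul_right (hc a ha s hs)).mul_left ((hc b hb t ht).symm.mul_right h2)
  · intro x hx
    obtain ⟨a, ha, t, ht, rfl⟩ := (mem_sup_of_le_centralizer h).1 hx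
    rw [(hc a ha t ht).mul_pow, hA.2 a ha, hT.2 t ht, one_mul]

theorem sup_inf_eq_left_of_le_centralizer {A T H : Subgroup G} (hAH : A ≤ H)
    (hTH : T ⊓ H = ⊥) (h : A ≤ Subgroup.centralizer (T : Set G)) : (A ⊔ T) ⊓ H = A := by
  refine le_antisymm ?_ (le_inf le_sup_left hAH)
  rintro x ⟨hx, hxH⟩
  obtain ⟨a, ha, t, ht, rfl⟩ := (mem_sup_of_le_centralizer h).1 hx
  have ht' : t ∈ T ⊓ H := ⟨ht, (H.mul_mem_cancel_left (hAH ha)).1 hxH⟩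
  rw [hTH, Subgroup.mem_bot] at ht'
  simpa [ht'] using ha

end ElementaryAbelian

/-- Let `H ≤ G` and `T ∈ A_p(G)` with `T ∩ H = 1`. Let
`N(H) = {X ∈ A_p(G) : X ∩ H ≠ 1}`. Then `A ↦ AT` is a well-defined order-preserving
map `A_p(C_H(T)) → N(H) ∩ A_p(G)_{>T}`, `X ↦ X ∩ H` is a well-defined order-preserving
map in the other direction, `r ∘ i = id` and `i ∘ r ≤ id`; consequently the geometric
realizations of the two order complexes are homotopy equivalent. -/
theorem stmt8 (G : Type) [Group G] [Finite G] (p : ℕ) (hp : p.Prime)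
    (H T : Subgroup G) (hT : T ∈ apSet p G) (hTH : T ⊓ H = ⊥) :
    (∀ A ∈ apSetIn p (H ⊓ Subgroup.centralizer (T : Set G)),
      A ⊔ T ∈ {X | X ∈ apSet p G ∧ X ⊓ H ≠ ⊥ ∧ T < X}) ∧
    (∀ A ∈ apSetIn p (H ⊓ Subgroup.centralizer (T : Set G)),
      ∀ A' ∈ apSetIn p (H ⊓ Subgroup.centralizer (T : Set G)),
        A ≤ A' → A ⊔ T ≤ A' ⊔ T) ∧
    (∀ X ∈ {X | X ∈ apSet p G ∧ X ⊓ H ≠ ⊥ ∧ T < X},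
      X ⊓ H ∈ apSetIn p (H ⊓ Subgroup.centralizer (T : Set G))) ∧
    (∀ X ∈ {X | X ∈ apSet p G ∧ X ⊓ H ≠ ⊥ ∧ T < X},
      ∀ X' ∈ {X | X ∈ apSet p G ∧ X ⊓ H ≠ ⊥ ∧ T < X},
        X ≤ X' → X ⊓ H ≤ X' ⊓ H) ∧
    (∀ A ∈ apSetIn p (H ⊓ Subgroup.centralizer (T : Set G)), (A ⊔ T) ⊓ H = A) ∧
    (∀ X ∈ {X | X ∈ apSet p G ∧ X ⊓ H ≠ ⊥ ∧ T < X}, (X ⊓ H) ⊔ T ≤ X) ∧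
    Nonempty
      (ContinuousMap.HomotopyEquiv
        ↥(geomRealOn (apSetIn p (H ⊓ Subgroup.centralizer (T : Set G))))
        ↥(geomRealOn {X | X ∈ apSet p G ∧ X ⊓ H ≠ ⊥ ∧ T < X})) := by
  have hi : ∀ A ∈ apSetIn p (H ⊓ Subgroup.centralizer (T : Set G)),
      A ⊔ T ∈ {X | X ∈ apSet p G ∧ X ⊓ H ≠ ⊥ ∧ T < X} := by
    rintro A ⟨hA, hAe, hAle⟩
    obtain ⟨hAH, hAT⟩ := le_inf_iff.1 hAle
    refine ⟨⟨fun h => hA (le_bot_iff.1 (le_sup_left.trans_eq h)), hAe.sup hT.2 hAT⟩, ?_, ?_⟩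
    · rwa [sup_inf_eq_left_of_le_centralizer hAH hTH hAT]
    · refine right_lt_sup.2 fun hle => hA (le_bot_iff.1 ?_)
      rw [← hTH]
      exact le_inf hle hAH
  have hr : ∀ X ∈ {X | X ∈ apSet p G ∧ X ⊓ H ≠ ⊥ ∧ T < X},
      X ⊓ H ∈ apSetIn p (H ⊓ Subgroup.centralizer (T : Set G)) := by
    rintro X ⟨⟨-, hXe⟩, hXH, hTX⟩
    refine ⟨hXH, hXe.mono inf_le_left, le_inf inf_le_right fun x hx => ?_⟩
    exact Subgroup.mem_centralizer_iff.2 fun t ht =>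
      (isElementaryAbelian_coe_iff.1 hXe).1 t (hTX.le ht) x hx.1
  have hri : ∀ A ∈ apSetIn p (H ⊓ Subgroup.centralizer (T : Set G)), (A ⊔ T) ⊓ H = A :=
    fun A hA => sup_inf_eq_left_of_le_centralizer (hA.2.2.trans inf_le_left) hTH
      (hA.2.2.trans inf_le_right)
  have hir : ∀ X ∈ {X | X ∈ apSet p G ∧ X ⊓ H ≠ ⊥ ∧ T < X}, (X ⊓ H) ⊔ T ≤ X :=
    fun X hX => sup_le inf_le_left hX.2.2.le
  have := Fintype.ofFinite (Subgroup G)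
  exact ⟨hi, fun A _ A' _ h => sup_le_sup_right h T, hr,
    fun X _ X' _ h => inf_le_inf_right H h, hri, hir,
    nonempty_homotopyEquiv_geomRealOn (i := (· ⊔ T)) (r := (· ⊓ H)) hi
      (fun A _ A' _ h => sup_le_sup_right h T) hr (fun X _ X' _ h => inf_le_inf_right H h)
      hri hir⟩
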